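/- The family of functions [[S₁]] • ⋯ • [[S_l]] (the indicator function of the Minkowski sum of the plates [S₁] + ⋯ + [S_l]), indexed by the standard composite set partitions {S₁,…,S_l} of {1,…,n}, is a basis of the ℚ-vector space spanned by the indicator functions of all plates of ordered set partitions of {1,…,n} (as functions V₀ⁿ → ℚ). -/

import Mathlib

open scoped Pointwise Classical

namespace PlatesPaper

/-- The union of a list of finite sets. -/
def lUnion {n : ℕ} (L : List (Finset (Fin n))) : Finset (Fin n) :=
  L.foldr (· ∪ ·) ∅

/-- `L` is an ordered set partition of `J`: a list of pairwise disjoint nonempty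
finite sets whose union is `J`. -/
def IsOSP {n : ℕ} (J : Finset (Fin n)) (L : List (Finset (Fin n))) : Prop :=
  (∀ B ∈ L, B.Nonempty) ∧ L.Pairwise Disjoint ∧ lUnion L = J

/-- The plate of an ordered set partition `L` (of a subset `J = lUnion L` of `{1,…,n}`):
the set of `x ∈ V₀ⁿ` vanishing outside `J`, with `x_J = 0`, and such that the partial
sums over the unions of the first `i` blocks are nonnegative for `i = 1,…,len(L)−1`.
(For an ordered set partition of the whole of `{1,…,n}` the first two conditions are
equivalent to `x ∈ V₀ⁿ`.) -/
def plate {n : ℕ} (L : List (Finset (Fin n))) : Set (Fin n → ℝ) :=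
  {x | (∑ i, x i = 0) ∧ (∀ j, j ∉ lUnion L → x j = 0) ∧ (∑ j ∈ lUnion L, x j = 0) ∧
    ∀ i : ℕ, 0 < i → i < L.length → 0 ≤ ∑ j ∈ lUnion (L.take i), x j}

/-- `ℚ`-valued indicator function of a set of points of `ℝⁿ`. -/
noncomputable def ind {n : ℕ} (S : Set (Fin n → ℝ)) : (Fin n → ℝ) → ℚ :=
  fun x => if x ∈ S then 1 else 0

/-- The index of the block of `L` containing the element `a`. -/
def blockIdx {n : ℕ} (L : List (Finset (Fin n))) (a : Fin n) : ℕ :=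
  L.findIdx fun B => decide (a ∈ B)

/-- The index of the block of `L` containing the set `B`. -/
def subIdx {n : ℕ} (L : List (Finset (Fin n))) (B : Finset (Fin n)) : ℕ :=
  L.findIdx fun C => decide (B ⊆ C)

/-- `B` is contained in one of the blocks of `L`. -/
def memBlock {n : ℕ} (L : List (Finset (Fin n))) (B : Finset (Fin n)) : Prop :=
  ∃ j < L.length, B ⊆ L.getD j ∅

/-- `F` is a standard composite set partition of `{1,…,n}`: an (unordered, finite)
collection of ordered set partitions of pairwise disjoint nonempty subsets of `{1,…,n}`
whose union is `{1,…,n}`, such that the first block of each member contains the minimum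
of its underlying set. -/
def IsStdCSP (n : ℕ) (F : Finset (List (Finset (Fin n)))) : Prop :=
  (∀ M ∈ F, IsOSP (lUnion M) M ∧ M ≠ []) ∧
  ((F : Set (List (Finset (Fin n)))).Pairwise fun M M' => Disjoint (lUnion M) (lUnion M')) ∧
  F.sup lUnion = Finset.univ ∧
  (∀ M ∈ F, ∃ b ∈ M.headD ∅, ∀ a ∈ lUnion M, b ≤ a)

lemma ite_mul_ite_one (P Q : Prop) [Decidable P] [Decidable Q] [Decidable (P ∧ Q)] :
    (if P then (1 : ℚ) else 0) * (if Q then (1 : ℚ) else 0) = if P ∧ Q then 1 else 0 := by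
  by_cases hP : P <;> by_cases hQ : Q <;> simp [hP, hQ]

lemma mem_lUnion {n : ℕ} (L : List (Finset (Fin n))) (a : Fin n) :
    a ∈ lUnion L ↔ ∃ B ∈ L, a ∈ B := by
  induction L with
  | nil => simp [lUnion]
  | cons B L ih =>
    have : lUnion (B :: L) = B ∪ lUnion L := rfl
    rw [this, Finset.mem_union, ih]; simp

lemma mem_lUnion_idx {n : ℕ} (L : List (Finset (Fin n))) (a : Fin n) :
    a ∈ lUnion L ↔ ∃ i, ∃ h : i < L.length, a ∈ L[i] := by
  rw [mem_lUnion]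
  constructor
  · rintro ⟨B, hB, ha⟩
    obtain ⟨i, h, rfl⟩ := List.getElem_of_mem hB
    exact ⟨i, h, ha⟩
  · rintro ⟨i, h, ha⟩
    exact ⟨_, List.getElem_mem h, ha⟩

lemma mem_lUnion_take {n : ℕ} (L : List (Finset (Fin n))) (k : ℕ) (a : Fin n) :
    a ∈ lUnion (L.take k) ↔ ∃ i, ∃ h : i < L.length, i < k ∧ a ∈ L[i] := by
  rw [mem_lUnion_idx]
  constructor
  · rintro ⟨i, h, ha⟩
    simp only [List.length_take, lt_min_iff] at h
    exact ⟨i, h.2, h.1, by simpa using ha⟩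
  · rintro ⟨i, h, hk, ha⟩
    exact ⟨i, by simp [h, hk], by simpa using ha⟩

lemma lUnion_append {n : ℕ} (L L' : List (Finset (Fin n))) :
    lUnion (L ++ L') = lUnion L ∪ lUnion L' := by
  ext a; simp only [mem_lUnion, Finset.mem_union, List.mem_append]
  grind

/-- the conditions that only need disjointness -/
lemma mem_sum_plate {n : ℕ} (F : Finset (List (Finset (Fin n))))
    (hd : (F : Set (List (Finset (Fin n)))).Pairwise
      fun M M' => Disjoint (lUnion M) (lUnion M'))
    (hu : F.sup lUnion = Finset.univ) (x : Fin n → ℝ) :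
    x ∈ ∑ M ∈ F, plate M ↔ ∀ M ∈ F, (∑ j ∈ lUnion M, x j = 0) ∧
      ∀ i : ℕ, 0 < i → i < M.length → 0 ≤ ∑ j ∈ lUnion (M.take i), x j := by
  have hsub : ∀ (M : List (Finset (Fin n))) i, lUnion (M.take i) ⊆ lUnion M := by
    intro M i a ha
    rw [mem_lUnion_take] at ha
    rw [mem_lUnion_idx]
    obtain ⟨j, h, -, h2⟩ := ha
    exact ⟨j, h, h2⟩
  rw [Set.mem_finsetSum]
  constructor
  · rintro ⟨g, hg, rfl⟩ M hM
    have key : ∀ A ⊆ lUnion M, ∑ j ∈ A, (∑ M ∈ F, g M) j = ∑ j ∈ A, g M j := by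
      intro A hA
      refine Finset.sum_congr rfl fun j hj => ?_
      rw [Finset.sum_apply]
      refine Finset.sum_eq_single_of_mem M hM fun M' hM' hne => ?_
      refine (hg hM').2.1 j fun hj' => ?_
      exact Finset.disjoint_left.1 (hd hM' hM hne) hj' (hA hj)
    refine ⟨?_, fun i h0 hi => ?_⟩
    · rw [key _ (Finset.Subset.refl _)]; exact (hg hM).2.2.1
    · rw [key _ (hsub M i)]; exact (hg hM).2.2.2 i h0 hi
  · intro h
    refine ⟨fun M j => if j ∈ lUnion M then x j else 0, ?_, ?_⟩
    · intro M hM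
      refine ⟨?_, ?_, ?_, ?_⟩
      · rw [← Finset.sum_filter]; simpa using (h M hM).1
      · intro j hj; simp [hj]
      · rw [Finset.sum_congr rfl (g := x)]
        · exact (h M hM).1
        · intro j hj; simp [hj]
      · intro i h0 hi
        rw [Finset.sum_congr rfl (g := x)]
        · exact (h M hM).2 i h0 hi
        · intro j hj; simp [hsub M i hj]
    · ext j
      rw [Finset.sum_apply]
      have hj : j ∈ F.sup lUnion := by rw [hu]; simp
      obtain ⟨M, hM, hjM⟩ := Finset.mem_sup.1 hj
      rw [Finset.sum_eq_single_of_mem M hM]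
      · simp [hjM]
      · intro M' hM' hne
        rw [if_neg]
        intro hj'
        exact (Finset.disjoint_left.1 (hd hM' hM hne) hj') hjM

/-! ### Part (a): the functions lie in the span of the plates -/

/-- indicator of all partial sums (including the total one) being nonnegative -/
noncomputable def hp {n : ℕ} (L : List (Finset (Fin n))) : (Fin n → ℝ) → ℚ :=
  fun x => if ∀ i ≤ L.length, 0 ≤ ∑ j ∈ lUnion (L.take i), x j then 1 else 0

lemma hp_snoc {n : ℕ} (L : List (Finset (Fin n))) (S : Finset (Fin n)) (x : Fin n → ℝ) :
    hp (L ++ [S]) x = (if 0 ≤ ∑ j ∈ lUnion (L ++ [S]), x j then 1 else 0) * hp L x := by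
  unfold hp
  rw [ite_mul_ite_one]
  refine if_congr ?_ rfl rfl
  constructor
  · intro h
    refine ⟨?_, fun i hi => ?_⟩
    · have := h (L.length + 1) (by simp)
      rwa [List.take_of_length_le (by simp)] at this
    · have := h i (by simp; omega)
      rwa [List.take_append_of_le_length hi] at this
  · rintro ⟨h1, h2⟩ i hi
    rcases Nat.lt_or_ge L.length i with h | h
    · rwa [List.take_of_length_le (by simp; omega)]
    · rw [List.take_append_of_le_length h]; exact h2 i h

lemma IsOSP.front {n : ℕ} {J : Finset (Fin n)} {L : List (Finset (Fin n))} {S : Finset (Fin n)}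
    (h : IsOSP J (L ++ [S])) : IsOSP (lUnion L) L ∧ S.Nonempty ∧ Disjoint (lUnion L) S ∧
      lUnion L ∪ S = J := by
  obtain ⟨h1, h2, h3⟩ := h
  rw [List.pairwise_append] at h2
  refine ⟨⟨fun B hB => h1 B (by simp [hB]), h2.1, rfl⟩, h1 S (by simp), ?_, ?_⟩
  · rw [Finset.disjoint_left]
    intro a ha haS
    obtain ⟨B, hB, haB⟩ := (mem_lUnion _ _).1 ha
    exact Finset.disjoint_left.1 (h2.2.2 B hB S (by simp)) haB haS
  · rw [← h3, lUnion_append]; simp [lUnion]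

lemma IsOSP.snoc {n : ℕ} {J : Finset (Fin n)} {L : List (Finset (Fin n))} {S : Finset (Fin n)}
    (h : IsOSP J L) (hS : S.Nonempty) (hd : Disjoint J S) : IsOSP (J ∪ S) (L ++ [S]) := by
  obtain ⟨h1, h2, h3⟩ := h
  refine ⟨?_, ?_, ?_⟩
  · intro B hB
    rcases List.mem_append.1 hB with h | h
    · exact h1 B h
    · simp at h; rw [h]; exact hS
  · rw [List.pairwise_append]
    refine ⟨h2, by simp, ?_⟩
    intro B hB C hC
    simp at hC; subst hC
    refine Finset.disjoint_of_subset_left ?_ hd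
    intro a ha; rw [← h3, mem_lUnion]; exact ⟨B, hB, ha⟩
  · rw [lUnion_append, h3]; simp [lUnion]

/-- span of the `hp Q`, `Q` an ordered set partition of `J` -/
noncomputable def spn {n : ℕ} (J : Finset (Fin n)) : Submodule ℚ ((Fin n → ℝ) → ℚ) :=
  Submodule.span ℚ (Set.range (fun L : {L : List (Finset (Fin n)) // IsOSP J L} => hp L.1))

lemma hp_mem_spn {n : ℕ} {J : Finset (Fin n)} {L : List (Finset (Fin n))} (h : IsOSP J L) :
    hp L ∈ spn J := Submodule.subset_span ⟨⟨L, h⟩, rfl⟩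

lemma spn_step {n : ℕ} {J S : Finset (Fin n)} (hS : S.Nonempty) (hd : Disjoint J S)
    {f : (Fin n → ℝ) → ℚ} (hf : f ∈ spn J) :
    (fun x => (if 0 ≤ ∑ j ∈ J ∪ S, x j then 1 else 0) * f x) ∈ spn (J ∪ S) := by
  unfold spn at hf
  induction hf using Submodule.span_induction with
  | mem f hf =>
    obtain ⟨⟨L, hL⟩, rfl⟩ := hf
    have := hp_mem_spn (hL.snoc hS hd)
    convert this using 1
    ext x
    rw [hp_snoc, (hL.snoc hS hd).2.2]
  | zero => 
    convert (spn (J ∪ S)).zero_mem using 1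
    ext x; simp
  | add f g _ _ hf hg =>
    convert (spn (J ∪ S)).add_mem hf hg using 1
    ext x; simp [mul_add]
  | smul c f _ hf =>
    convert (spn (J ∪ S)).smul_mem c hf using 1
    ext x; simp

lemma hp_nil {n : ℕ} (x : Fin n → ℝ) : hp [] x = 1 := by
  simp [hp, lUnion]

lemma hp_mul_mem {n : ℕ} (k : ℕ) : ∀ (J J' : Finset (Fin n)) (L L' : List (Finset (Fin n))),
    L.length + L'.length ≤ k → IsOSP J L → IsOSP J' L' → Disjoint J J' →
    (fun x => hp L x * hp L' x) ∈ spn (J ∪ J') := by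
  induction k with
  | zero =>
    intro J J' L L' hk hL hL' hd
    have h1 : L = [] := List.length_eq_zero_iff.1 (by omega)
    have h2 : L' = [] := List.length_eq_zero_iff.1 (by omega)
    subst h1 h2
    have e1 := hL.2.2
    have e2 := hL'.2.2
    simp only [hp_nil]
    have : IsOSP (J ∪ J') [] := by
      rw [← e1, ← e2]; simp [lUnion, IsOSP]
    convert hp_mem_spn this using 1
    ext x; simp [hp_nil]
  | succ k ih =>
    intro J J' L L' hk hL hL' hd
    rcases List.eq_nil_or_concat L with rfl | ⟨A, S, rfl⟩
    · have e1 : J = ∅ := hL.2.2.symm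
      subst e1
      have e : (fun x : Fin n → ℝ => hp [] x * hp L' x) = hp L' := by
        ext x; simp [hp_nil]
      rw [e, Finset.empty_union]
      exact hp_mem_spn hL'
    rcases List.eq_nil_or_concat L' with rfl | ⟨A', S', rfl⟩
    · have e1 : J' = ∅ := hL'.2.2.symm
      subst e1
      have e : (fun x : Fin n → ℝ => hp (A.concat S) x * hp [] x) = hp (A.concat S) := by
        ext x; simp [hp_nil]
      rw [e, Finset.union_empty]
      exact hp_mem_spn hL
    simp only [List.concat_eq_append, List.length_append, List.length_singleton] at *
    obtain ⟨hA, hS, hAS, e⟩ := hL.front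
    obtain ⟨hA', hS', hAS', e'⟩ := hL'.front
    have hun : lUnion (A ++ [S]) = J := hL.2.2
    have hun' : lUnion (A' ++ [S']) = J' := hL'.2.2
    have hJ : lUnion A ⊆ J := by rw [← e]; exact Finset.subset_union_left
    have hJS : S ⊆ J := by rw [← e]; exact Finset.subset_union_right
    have hJ' : lUnion A' ⊆ J' := by rw [← e']; exact Finset.subset_union_left
    have hJS' : S' ⊆ J' := by rw [← e']; exact Finset.subset_union_right
    have m1 := ih (lUnion A) J' A (A' ++ [S']) (by simp; omega) hA hL'
      (Finset.disjoint_of_subset_left hJ hd)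
    have m2 := ih J (lUnion A') (A ++ [S]) A' (by simp; omega) hL hA'
      (Finset.disjoint_of_subset_right hJ' hd)
    have m3 := ih (lUnion A) (lUnion A') A A' (by omega) hA hA'
      (Finset.disjoint_of_subset_left hJ (Finset.disjoint_of_subset_right hJ' hd))
    have d1 := Finset.disjoint_of_subset_left hJS hd
    have d2 := Finset.disjoint_of_subset_right hJS' hd
    have s1 := spn_step (S := S) hS (by
      rw [Finset.disjoint_union_left]; exact ⟨hAS, d1.symm⟩) m1
    have s2 := spn_step (S := S') hS' (by
      rw [Finset.disjoint_union_left]; exact ⟨d2, hAS'⟩) m2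
    have s3 := spn_step (S := S ∪ S') (hS.mono Finset.subset_union_left) (by
      rw [Finset.disjoint_union_left, Finset.disjoint_union_right, Finset.disjoint_union_right]
      exact ⟨⟨hAS, Finset.disjoint_of_subset_left hJ d2⟩,
        ⟨(Finset.disjoint_of_subset_right hJ' d1).symm, hAS'⟩⟩) m3
    have u1 : lUnion A ∪ J' ∪ S = J ∪ J' := by rw [← e]; ext; simp only [Finset.mem_union]; tauto
    have u2 : J ∪ lUnion A' ∪ S' = J ∪ J' := by rw [← e']; ext; simp only [Finset.mem_union]; tauto
    have u3 : lUnion A ∪ lUnion A' ∪ (S ∪ S') = J ∪ J' := by rw [← e, ← e']; ext; simp only [Finset.mem_union]; tauto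
    rw [u1] at s1
    rw [u2] at s2
    rw [u3] at s3
    convert (spn (J ∪ J')).sub_mem ((spn (J ∪ J')).add_mem s1 s2) s3 using 1
    ext x
    simp only [Pi.add_apply, Pi.sub_apply, hp_snoc, hun, hun']
    rw [Finset.sum_union hd]
    generalize ∑ j ∈ J, x j = a
    generalize ∑ j ∈ J', x j = b
    by_cases ha : 0 ≤ a <;> by_cases hb : 0 ≤ b
    · simp [ha, hb, add_nonneg ha hb]
    · simp [ha, hb]
    · simp [ha, hb]
    · have : ¬ 0 ≤ a + b := by push Not at *; linarith
      simp [ha, hb, this]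

lemma spn_mul {n : ℕ} {J J' : Finset (Fin n)} (hd : Disjoint J J') {L : List (Finset (Fin n))}
    (hL : IsOSP J L) {f : (Fin n → ℝ) → ℚ} (hf : f ∈ spn J') :
    (fun x => hp L x * f x) ∈ spn (J ∪ J') := by
  unfold spn at hf
  induction hf using Submodule.span_induction with
  | mem f hf =>
    obtain ⟨⟨L', hL'⟩, rfl⟩ := hf
    exact hp_mul_mem _ J J' L L' le_rfl hL hL' hd
  | zero => 
    convert (spn (J ∪ J')).zero_mem using 1
    ext x; simp
  | add f g _ _ hf hg =>
    convert (spn (J ∪ J')).add_mem hf hg using 1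
    ext x; simp [mul_add]
  | smul c f _ hf =>
    convert (spn (J ∪ J')).smul_mem c hf using 1
    ext x; simp; ring

lemma prod_mem_spn {n : ℕ} (F : Finset (List (Finset (Fin n))))
    (h1 : ∀ M ∈ F, IsOSP (lUnion M) M)
    (hd : (F : Set (List (Finset (Fin n)))).Pairwise
      fun M M' => Disjoint (lUnion M) (lUnion M')) :
    (fun x => ∏ M ∈ F, hp M x) ∈ spn (F.sup lUnion) := by
  induction F using Finset.induction_on with
  | empty =>
    have : IsOSP (∅ : Finset (Fin n)) [] := by simp [IsOSP, lUnion]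
    have e : (fun x : Fin n → ℝ => ∏ M ∈ (∅ : Finset (List (Finset (Fin n)))), hp M x) = hp [] := by
      ext x; simp [hp_nil]
    rw [e]
    exact hp_mem_spn this
  | insert M F hM ih =>
    rw [Finset.sup_insert]
    simp only [Finset.prod_insert hM]
    refine spn_mul ?_ (h1 M (by simp)) (ih (fun M' h => h1 M' (by simp [h]))
      (hd.mono (by simp)))
    rw [Finset.disjoint_sup_right]
    intro M' hM'
    exact hd (by simp) (by simp [hM']) (by rintro rfl; exact hM hM')

lemma ind_sum_mem {n : ℕ} (F : Finset (List (Finset (Fin n)))) (hF : IsStdCSP n F) :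
    ind (∑ M ∈ F, plate M) ∈ Submodule.span ℚ (Set.range
      (fun L : {L : List (Finset (Fin n)) // IsOSP Finset.univ L} => ind (plate L.1))) := by
  obtain ⟨h1, hd, hu, -⟩ := hF
  have hm := prod_mem_spn F (fun M hM => (h1 M hM).1) hd
  rw [hu] at hm
  have key : ∀ f ∈ spn (Finset.univ : Finset (Fin n)),
      (fun x : Fin n → ℝ => (if ∑ i, x i = 0 then 1 else 0) * f x) ∈ Submodule.span ℚ (Set.range
      (fun L : {L : List (Finset (Fin n)) // IsOSP Finset.univ L} => ind (plate L.1))) := by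
    intro f hf
    unfold spn at hf
    induction hf using Submodule.span_induction with
    | mem f hf =>
      obtain ⟨⟨L, hL⟩, rfl⟩ := hf
      refine Submodule.subset_span ⟨⟨L, hL⟩, ?_⟩
      ext x
      simp only [ind, hp, plate, hL.2.2, Set.mem_ofPred_eq]
      rw [ite_mul_ite_one]
      refine if_congr ?_ rfl rfl
      constructor
      · rintro ⟨a, -, -, b⟩
        refine ⟨a, fun i hi => ?_⟩
        rcases Nat.eq_zero_or_pos i with rfl | h0
        · simp [lUnion]
        rcases hi.eq_or_lt with rfl | hi
        · rw [List.take_length, hL.2.2, a]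
        · exact b i h0 hi
      · rintro ⟨a, b⟩
        exact ⟨a, by simp, a, fun i _ hi => b i hi.le⟩
    | zero => 
      convert Submodule.zero_mem _ using 1
      ext x; simp
    | add f g _ _ hf hg =>
      convert Submodule.add_mem _ hf hg using 1
      ext x; simp [mul_add]
    | smul c f _ hf =>
      convert Submodule.smul_mem _ c hf using 1
      ext x; simp
  convert key _ hm using 1
  ext x
  simp only [ind, mem_sum_plate F hd hu]
  have htot : ∑ i, x i = ∑ M ∈ F, ∑ j ∈ lUnion M, x j := by
    rw [← Finset.sum_biUnion hd, ← Finset.sup_eq_biUnion, hu]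
  unfold hp
  rw [Finset.prod_ite_zero, Finset.prod_const_one, ite_mul_ite_one]
  refine if_congr ?_ rfl rfl
  constructor
  · intro h
    refine ⟨?_, fun M hM i hi => ?_⟩
    · rw [htot]; exact Finset.sum_eq_zero fun M hM => (h M hM).1
    · rcases Nat.eq_zero_or_pos i with rfl | h0
      · simp [lUnion]
      rcases hi.eq_or_lt with rfl | hi
      · rw [List.take_length, (h M hM).1]
      · exact (h M hM).2 i h0 hi
  · rintro ⟨a, b⟩ M hM
    refine ⟨?_, fun i _ hi => b M hM i hi.le⟩
    rw [htot] at a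
    refine (Finset.sum_eq_zero_iff_of_nonneg fun M hM => ?_).1 a M hM
    simpa using b M hM _ le_rfl

/-! ### Part (b): counting -/

/-- comparison of components: the minimum of the second is below the first -/
def rlt {n : ℕ} (M M' : List (Finset (Fin n))) : Prop :=
  ∃ b ∈ M'.headD ∅, ∀ a ∈ lUnion M, b < a

lemma headD_sub {n : ℕ} {M : List (Finset (Fin n))} {b : Fin n} (h : b ∈ M.headD ∅) :
    b ∈ lUnion M := by
  cases M with
  | nil => simp at h
  | cons B M => exact (mem_lUnion _ _).2 ⟨B, by simp, by simpa using h⟩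

lemma rlt_asymm {n : ℕ} (M M' : List (Finset (Fin n))) (h : rlt M M') (h' : rlt M' M) : False := by
  obtain ⟨b, hb, h1⟩ := h
  obtain ⟨c, hc, h2⟩ := h'
  exact lt_asymm (h1 c (headD_sub hc)) (h2 b (headD_sub hb))

lemma exists_split {n : ℕ} (k : ℕ) : ∀ L : List (Finset (Fin n)), L.length ≤ k →
    IsOSP (lUnion L) L → ∃ Ls : List (List (Finset (Fin n))), Ls.flatten = L ∧ Ls.Pairwise rlt ∧
      ∀ M ∈ Ls, M ≠ [] ∧ ∃ b ∈ M.headD ∅, ∀ a ∈ lUnion M, b ≤ a := by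
  induction k with
  | zero =>
    intro L hL _
    have : L = [] := List.length_eq_zero_iff.1 (by omega)
    exact ⟨[], by simp [this]⟩
  | succ k ih =>
    intro L hL hO
    rcases Finset.eq_empty_or_nonempty (lUnion L) with he | hne
    · have : L = [] := by
        rw [List.eq_nil_iff_forall_not_mem]
        intro B hB
        obtain ⟨a, ha⟩ := hO.1 B hB
        have : a ∈ lUnion L := (mem_lUnion _ _).2 ⟨B, hB, ha⟩
        simp [he] at this
      exact ⟨[], by simp [this]⟩
    · set m := (lUnion L).min' hne with hm
      obtain ⟨B, hB, hmB⟩ := (mem_lUnion _ _).1 ((lUnion L).min'_mem hne)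
      have hmin : ∀ a ∈ lUnion L, m ≤ a := fun a ha => (lUnion L).min'_le a ha
      obtain ⟨A, C, rfl⟩ := List.append_of_mem hB
      have hp := List.pairwise_append.1 hO.2.1
      obtain ⟨Ls, e, hLs, hstd⟩ := ih A (by simp at hL; omega)
        ⟨fun B hB => hO.1 B (by simp [hB]), hp.1, rfl⟩
      refine ⟨Ls ++ [B :: C], by simp [e], ?_, ?_⟩
      · rw [List.pairwise_append]
        refine ⟨hLs, by simp, ?_⟩
        intro M hM M' hM'
        simp at hM'
        subst hM'
        refine ⟨m, by simpa using hmB, ?_⟩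
        intro a ha
        obtain ⟨D, hD, haD⟩ := (mem_lUnion _ _).1 ha
        have hDA : D ∈ A := by rw [← e]; exact List.mem_flatten.2 ⟨M, hM, hD⟩
        refine lt_of_le_of_ne (hmin a ((mem_lUnion _ _).2 ⟨D, by simp [hDA], haD⟩)) ?_
        rintro rfl
        exact Finset.disjoint_left.1 (hp.2.2 D hDA B (by simp)) haD hmB
      · intro M hM
        rcases List.mem_append.1 hM with h | h
        · exact hstd M h
        · simp at h
          subst h
          refine ⟨by simp, m, by simpa using hmB, fun a ha => hmin a ?_⟩
          rw [lUnion_append]; exact Finset.mem_union_right _ ha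

lemma exists_csp {n : ℕ} (L : List (Finset (Fin n))) (hL : IsOSP Finset.univ L) :
    ∃ F : Finset (List (Finset (Fin n))), IsStdCSP n F ∧
      ∃ Ls : List (List (Finset (Fin n))), Ls.flatten = L ∧ Ls.Pairwise rlt ∧ Ls.toFinset = F := by
  obtain ⟨Ls, e, hp, hstd⟩ := exists_split L.length L le_rfl ⟨hL.1, hL.2.1, rfl⟩
  have hpw := hL.2.1
  rw [← e, List.pairwise_flatten] at hpw
  refine ⟨Ls.toFinset, ⟨?_, ?_, ?_, ?_⟩, Ls, e, hp, rfl⟩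
  · intro M hM
    rw [List.mem_toFinset] at hM
    refine ⟨⟨fun B hB => hL.1 B ?_, hpw.1 M hM, rfl⟩, (hstd M hM).1⟩
    rw [← e]; exact List.mem_flatten.2 ⟨M, hM, hB⟩
  · have h2 : Ls.Pairwise fun M M' => Disjoint (lUnion M) (lUnion M') := by
      refine hpw.2.imp ?_
      intro M M' h
      rw [Finset.disjoint_left]
      intro a ha ha'
      obtain ⟨B, hB, haB⟩ := (mem_lUnion _ _).1 ha
      obtain ⟨B', hB', haB'⟩ := (mem_lUnion _ _).1 ha'
      exact Finset.disjoint_left.1 (h B hB B' hB') haB haB'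
    intro M hM M' hM' hne
    have : Std.Symm (fun M M' : List (Finset (Fin n)) => Disjoint (lUnion M) (lUnion M')) :=
      ⟨fun _ _ h => Disjoint.symm h⟩
    exact h2.forall (by simpa using hM) (by simpa using hM') hne
  · ext a
    simp only [Finset.mem_univ, iff_true, Finset.mem_sup, List.mem_toFinset]
    have : a ∈ lUnion L := by rw [hL.2.2]; simp
    obtain ⟨B, hB, haB⟩ := (mem_lUnion _ _).1 this
    rw [← e] at hB
    obtain ⟨M, hM, hBM⟩ := List.mem_flatten.1 hB
    exact ⟨M, hM, (mem_lUnion _ _).2 ⟨B, hBM, haB⟩⟩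
  · intro M hM
    exact (hstd M (by simpa using hM)).2

lemma exists_inj (n : ℕ) : ∃ f : {L : List (Finset (Fin n)) // IsOSP Finset.univ L} →
    {F : Finset (List (Finset (Fin n))) // IsStdCSP n F}, Function.Injective f := by
  choose f hf Ls h1 h2 h3 using fun L : {L : List (Finset (Fin n)) // IsOSP Finset.univ L} =>
    exists_csp L.1 L.2
  refine ⟨fun L => ⟨f L, hf L⟩, ?_⟩
  intro L L' h
  simp only [Subtype.mk.injEq] at h
  have nd : ∀ L, (Ls L).Nodup := fun L => (h2 L).imp (fun {a b} hab e => by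
    subst e; exact rlt_asymm _ _ hab hab)
  have hperm : (Ls L).Perm (Ls L') := by
    rw [List.perm_ext_iff_of_nodup (nd L) (nd L')]
    intro a
    rw [← List.mem_toFinset, ← List.mem_toFinset, h3, h3, h]
  have : Ls L = Ls L' := hperm.eq_of_pairwise
    (fun a b _ _ hab hba => (rlt_asymm a b hab hba).elim) (h2 L) (h2 L')
  apply Subtype.ext
  have e1 := h1 L'
  have e2 := h1 L
  rw [← e2, ← e1, this]

/-! ### Part (c): linear independence -/

/-- the point with weights `w` along the forest `par` -/
noncomputable def pt {n : ℕ} (par : Fin n → Fin n) (w : Fin n → ℝ) : Fin n → ℝ :=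
  fun j => ∑ v, w v * ((if par v = j then 1 else 0) - (if v = j then 1 else 0))

/-- the incidence coefficient -/
noncomputable def dc {n : ℕ} (par : Fin n → Fin n) (A : Finset (Fin n)) (v : Fin n) : ℝ :=
  (if par v ∈ A then 1 else 0) - (if v ∈ A then 1 else 0)

lemma sum_pt {n : ℕ} (par : Fin n → Fin n) (w : Fin n → ℝ) (A : Finset (Fin n)) :
    ∑ j ∈ A, pt par w j = ∑ v, w v * dc par A v := by
  unfold pt dc
  rw [Finset.sum_comm]
  refine Finset.sum_congr rfl fun v _ => ?_
  rw [← Finset.mul_sum, Finset.sum_sub_distrib, Finset.sum_ite_eq, Finset.sum_ite_eq]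

lemma dc_eq_zero {n : ℕ} (par : Fin n → Fin n) (A : Finset (Fin n)) (v : Fin n) :
    dc par A v = 0 ↔ (par v ∈ A ↔ v ∈ A) := by
  unfold dc
  by_cases h1 : par v ∈ A <;> by_cases h2 : v ∈ A <;> simp [h1, h2]

lemma abs_dc {n : ℕ} (par : Fin n → Fin n) (A : Finset (Fin n)) (v : Fin n)
    (h : dc par A v ≠ 0) : |dc par A v| = 1 := by
  rw [Ne, dc_eq_zero] at h
  unfold dc
  by_cases h1 : par v ∈ A <;> by_cases h2 : v ∈ A <;> simp_all

/-- `v` is the cut edge of largest weight -/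
def MaxCut {n : ℕ} (par : Fin n → Fin n) (κ : Fin n → ℕ) (A : Finset (Fin n)) (v : Fin n) : Prop :=
  dc par A v ≠ 0 ∧ ∀ u, dc par A u ≠ 0 → κ u ≤ κ v

lemma maxCut_unique {n : ℕ} {par : Fin n → Fin n} {κ : Fin n → ℕ} (hκ : Function.Injective κ)
    {A : Finset (Fin n)} {v u : Fin n} (h : MaxCut par κ A v) (h' : MaxCut par κ A u) : v = u :=
  hκ (le_antisymm (h'.2 v h.1) (h.2 u h'.1))

lemma maxCut_exists {n : ℕ} (par : Fin n → Fin n) (κ : Fin n → ℕ)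
    (A : Finset (Fin n)) (h : ¬ ∀ v, dc par A v = 0) : ∃ v, MaxCut par κ A v := by
  push Not at h
  obtain ⟨v, hv⟩ := h
  obtain ⟨u, hu, hmax⟩ := Finset.exists_max_image
    (Finset.univ.filter fun v => dc par A v ≠ 0) κ ⟨v, by simpa using hv⟩
  exact ⟨u, by simpa using hu, fun x hx => hmax x (by simpa using hx)⟩

lemma dom {n : ℕ} (par : Fin n → Fin n) (κ : Fin n → ℕ) (hκ : Function.Injective κ)
    (w : Fin n → ℝ) (hw : ∀ v, |w v| = 2 ^ κ v) (A : Finset (Fin n)) (v : Fin n)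
    (h : MaxCut par κ A v) :
    |∑ j ∈ A, pt par w j - w v * dc par A v| < 2 ^ κ v ∧ |w v * dc par A v| = 2 ^ κ v := by
  refine ⟨?_, by rw [abs_mul, hw, abs_dc par A v h.1, mul_one]⟩
  rw [sum_pt, ← Finset.add_sum_erase _ _ (Finset.mem_univ v), add_sub_cancel_left]
  set s := (Finset.univ.erase v).filter fun u => dc par A u ≠ 0 with hs
  have h1 : ∑ u ∈ Finset.univ.erase v, w u * dc par A u = ∑ u ∈ s, w u * dc par A u := by
    rw [hs, Finset.sum_filter]
    refine Finset.sum_congr rfl fun u _ => ?_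
    by_cases hu : dc par A u = 0 <;> simp [hu]
  rw [h1]
  have h2 : ∑ u ∈ s, |w u * dc par A u| = ((∑ m ∈ s.image κ, 2 ^ m : ℕ) : ℝ) := by
    rw [Finset.sum_image (fun a _ b _ hab => hκ hab)]
    push_cast
    refine Finset.sum_congr rfl fun u hu => ?_
    rw [abs_mul, hw, abs_dc par A u (Finset.mem_filter.1 hu).2, mul_one]
  refine lt_of_le_of_lt (Finset.abs_sum_le_sum_abs _ _) ?_
  rw [h2]
  have h3 : ∑ m ∈ s.image κ, 2 ^ m < 2 ^ κ v := by
    refine Nat.geomSum_lt le_rfl ?_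
    intro m hm
    obtain ⟨u, hu, rfl⟩ := Finset.mem_image.1 hm
    rw [hs, Finset.mem_filter, Finset.mem_erase] at hu
    exact lt_of_le_of_ne (h.2 u hu.2) (fun e => hu.1.1 (hκ e))
  exact_mod_cast h3

lemma sum_pt_eq_zero {n : ℕ} (par : Fin n → Fin n) (κ : Fin n → ℕ) (hκ : Function.Injective κ)
    (w : Fin n → ℝ) (hw : ∀ v, |w v| = 2 ^ κ v) (A : Finset (Fin n)) :
    ∑ j ∈ A, pt par w j = 0 ↔ ∀ v, dc par A v = 0 := by
  constructor
  · intro h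
    by_contra hc
    obtain ⟨v, hv⟩ := maxCut_exists par κ A hc
    obtain ⟨h1, h2⟩ := dom par κ hκ w hw A v hv
    rw [h, zero_sub, abs_neg, h2] at h1
    exact lt_irrefl _ h1
  · intro h
    rw [sum_pt]; simp [h]

lemma sum_pt_nonneg {n : ℕ} (par : Fin n → Fin n) (κ : Fin n → ℕ) (hκ : Function.Injective κ)
    (w : Fin n → ℝ) (hw : ∀ v, |w v| = 2 ^ κ v) (A : Finset (Fin n)) (v : Fin n)
    (h : MaxCut par κ A v) :
    0 ≤ ∑ j ∈ A, pt par w j ↔ 0 ≤ w v * dc par A v := by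
  obtain ⟨h1, h2⟩ := dom par κ hκ w hw A v h
  rw [abs_lt] at h1
  rcases le_or_gt 0 (w v * dc par A v) with h0 | h0
  · rw [abs_of_nonneg h0] at h2
    refine ⟨fun _ => h0, fun _ => by linarith⟩
  · rw [abs_of_neg h0] at h2
    refine ⟨fun _ => by linarith, fun _ => by linarith⟩

/-- combinatorial data of a standard composite set partition -/
structure Dat (n : ℕ) where
  comp : Fin n → List (Finset (Fin n))
  idx : Fin n → ℕ
  idx_lt : ∀ u, idx u < (comp u).length
  ex : ∀ u i, i < (comp u).length → ∃ w, comp w = comp u ∧ idx w = i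
  std : ∀ u, ∃ b, comp b = comp u ∧ idx b = 0 ∧ ∀ w, comp w = comp u → b ≤ w

namespace Dat

variable {n : ℕ}

/-- `D` describes `F` -/
def For (D : Dat n) (F : Finset (List (Finset (Fin n)))) : Prop :=
  ∀ M i u, (M ∈ F ∧ ∃ h : i < M.length, u ∈ M[i]) ↔ (D.comp u = M ∧ D.idx u = i)

/-- component of `v` -/
noncomputable def K (D : Dat n) (v : Fin n) : Finset (Fin n) :=
  Finset.univ.filter fun j => D.comp j = D.comp v

/-- initial part of a component -/
noncomputable def T (D : Dat n) (v : Fin n) (i : ℕ) : Finset (Fin n) :=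
  Finset.univ.filter fun j => D.comp j = D.comp v ∧ D.idx j < i

/-- the cone -/
def cone (D : Dat n) : Set (Fin n → ℝ) :=
  {x | ∀ v, (∑ j ∈ D.K v, x j = 0) ∧
    ∀ i, 0 < i → i < (D.comp v).length → 0 ≤ ∑ j ∈ D.T v i, x j}

lemma exists_for (F : Finset (List (Finset (Fin n)))) (hF : IsStdCSP n F) :
    ∃ D : Dat n, D.For F := by
  obtain ⟨h1, hd, hu, hs⟩ := hF
  have hex : ∀ u : Fin n, ∃ M i, M ∈ F ∧ ∃ h : i < M.length, u ∈ M[i] := by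
    intro u
    have : u ∈ F.sup lUnion := by rw [hu]; simp
    obtain ⟨M, hM, h⟩ := Finset.mem_sup.1 this
    obtain ⟨i, hi, h⟩ := (mem_lUnion_idx _ _).1 h
    exact ⟨M, i, hM, hi, h⟩
  choose comp idx hM hi hm using hex
  have key : ∀ M i u, (M ∈ F ∧ ∃ h : i < M.length, u ∈ M[i]) ↔ (comp u = M ∧ idx u = i) := by
    intro M i u
    constructor
    · rintro ⟨a, b, c⟩
      have e : comp u = M := by
        by_contra hne
        exact Finset.disjoint_left.1 (hd (hM u) a hne)
          ((mem_lUnion_idx _ _).2 ⟨_, hi u, hm u⟩) ((mem_lUnion_idx _ _).2 ⟨_, b, c⟩)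
      subst e
      refine ⟨rfl, ?_⟩
      by_contra hne
      have hp := (h1 _ (hM u)).1.2.1
      rw [List.pairwise_iff_getElem] at hp
      rcases Nat.lt_or_gt_of_ne hne with hl | hl
      · exact Finset.disjoint_left.1 (hp _ _ (hi u) b hl) (hm u) c
      · exact Finset.disjoint_left.1 (hp _ _ b (hi u) hl) c (hm u)
    · rintro ⟨rfl, rfl⟩
      exact ⟨hM u, hi u, hm u⟩
  refine ⟨⟨comp, idx, hi, ?_, ?_⟩, key⟩
  · intro u i h
    obtain ⟨w, hw⟩ := (h1 _ (hM u)).1.1 _ (List.getElem_mem h)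
    exact ⟨w, (key _ _ _).1 ⟨hM u, h, hw⟩⟩
  · intro u
    obtain ⟨b, hb, hmin⟩ := hs _ (hM u)
    have hlen : 0 < (comp u).length := lt_of_le_of_lt (Nat.zero_le _) (hi u)
    have hb' : b ∈ (comp u)[0] := by
      rw [List.headD_eq_head?_getD, List.head?_eq_getElem?, List.getElem?_eq_getElem hlen] at hb
      simpa using hb
    obtain ⟨e1, e2⟩ := (key _ _ _).1 ⟨hM u, hlen, hb'⟩
    refine ⟨b, e1, e2, fun w hw => hmin w ?_⟩
    rw [← hw]
    exact (mem_lUnion_idx _ _).2 ⟨_, hi w, hm w⟩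

lemma For.lUnion_take {D : Dat n} {F : Finset (List (Finset (Fin n)))} (h : D.For F)
    (v : Fin n) (i : ℕ) : lUnion ((D.comp v).take i) = D.T v i := by
  have hv := (h _ _ v).2 ⟨rfl, rfl⟩
  ext a
  rw [mem_lUnion_take]
  simp only [T, Finset.mem_filter, Finset.mem_univ, true_and]
  constructor
  · rintro ⟨j, hj, hji, ha⟩
    obtain ⟨e1, e2⟩ := (h _ _ a).1 ⟨hv.1, hj, ha⟩
    exact ⟨e1, by omega⟩
  · rintro ⟨e, hlt⟩
    obtain ⟨-, h1, h2⟩ := (h _ _ a).2 ⟨e, rfl⟩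
    exact ⟨_, h1, hlt, h2⟩

lemma For.lUnion_eq {D : Dat n} {F : Finset (List (Finset (Fin n)))} (h : D.For F)
    (v : Fin n) : lUnion (D.comp v) = D.K v := by
  have := h.lUnion_take v (D.comp v).length
  rw [List.take_length] at this
  rw [this]
  ext a
  simp only [T, K, Finset.mem_filter, Finset.mem_univ, true_and, and_iff_left_iff_imp]
  intro e
  rw [← e]; exact D.idx_lt a

lemma For.mem_iff {D : Dat n} {F : Finset (List (Finset (Fin n)))} (h : D.For F)
    (hF : IsStdCSP n F) (M : List (Finset (Fin n))) : M ∈ F ↔ ∃ v, D.comp v = M := by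
  constructor
  · intro hM
    obtain ⟨⟨h1, -, -⟩, h2⟩ := hF.1 M hM
    have hl : 0 < M.length := List.length_pos_iff.2 h2
    obtain ⟨u, hu⟩ := h1 _ (List.getElem_mem hl)
    exact ⟨u, ((h _ _ u).1 ⟨hM, hl, hu⟩).1⟩
  · rintro ⟨v, rfl⟩
    exact ((h _ _ v).2 ⟨rfl, rfl⟩).1

lemma For.cone_eq {D : Dat n} {F : Finset (List (Finset (Fin n)))} (h : D.For F)
    (hF : IsStdCSP n F) : ∑ M ∈ F, plate M = D.cone := by
  ext x
  rw [mem_sum_plate F hF.2.1 hF.2.2.1]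
  constructor
  · intro hx v
    have := hx (D.comp v) ((h.mem_iff hF _).2 ⟨v, rfl⟩)
    simpa only [h.lUnion_eq, h.lUnion_take] using this
  · intro hx M hM
    obtain ⟨v, rfl⟩ := (h.mem_iff hF _).1 hM
    simpa only [h.lUnion_eq, h.lUnion_take] using hx v

lemma length_le (D : Dat n) (v : Fin n) : (D.comp v).length ≤ n := by
  choose f hf1 hf2 using D.ex v
  have := Fintype.card_le_of_injective
    (fun i : Fin (D.comp v).length => f i.1 i.2) (fun i j hij => by
      apply Fin.ext
      rw [← hf2 i.1 i.2, ← hf2 j.1 j.2]; exact congrArg D.idx hij)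
  simpa using this

/-- two data sets with equal lists come from the same partition -/
lemma For.eq {D E : Dat n} {F G : Finset (List (Finset (Fin n)))} (hD : D.For F) (hE : E.For G)
    (hF : IsStdCSP n F) (hG : IsStdCSP n G)
    (hK : ∀ v, D.K v = E.K v)
    (hl : ∀ v, (D.comp v).length = (E.comp v).length) (hi : ∀ v, D.idx v = E.idx v) : F = G := by
  have hc : ∀ v, D.comp v = E.comp v := by
    intro v
    refine List.ext_getElem (hl v) ?_
    intro i h1 h2
    ext a
    have a1 := hD (D.comp v) i a
    have a2 := hE (E.comp v) i a
    have b1 : D.comp v ∈ F := (hD.mem_iff hF _).2 ⟨v, rfl⟩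
    have b2 : E.comp v ∈ G := (hE.mem_iff hG _).2 ⟨v, rfl⟩
    have c1 : a ∈ (D.comp v)[i] ↔ (D.comp a = D.comp v ∧ D.idx a = i) := by
      rw [← a1]; exact ⟨fun h => ⟨b1, h1, h⟩, fun h => h.2.2⟩
    have c2 : a ∈ (E.comp v)[i] ↔ (E.comp a = E.comp v ∧ E.idx a = i) := by
      rw [← a2]; exact ⟨fun h => ⟨b2, h2, h⟩, fun h => h.2.2⟩
    have hk := Finset.ext_iff.1 (hK v) a
    simp only [K, Finset.mem_filter, Finset.mem_univ, true_and] at hk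
    rw [c1, c2, hk, hi]
  ext M
  rw [hD.mem_iff hF, hE.mem_iff hG]
  simp only [hc]

/-- a chosen element of the `i`-th block of the component of `v` -/
noncomputable def pick (D : Dat n) (v : Fin n) (i : ℕ) : Fin n :=
  if h : ∃ w, D.comp w = D.comp v ∧ D.idx w = i then h.choose else v

lemma pick_spec (D : Dat n) (v : Fin n) (i : ℕ) (hi : i < (D.comp v).length) :
    D.comp (D.pick v i) = D.comp v ∧ D.idx (D.pick v i) = i := by
  have h := D.ex v i hi
  unfold pick
  rw [dif_pos h]
  exact h.choose_spec

lemma pick_congr (D : Dat n) {u v : Fin n} (i : ℕ) (hi : i < (D.comp v).length)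
    (h : D.comp u = D.comp v) : D.pick u i = D.pick v i := by
  have hex := D.ex v i hi
  unfold pick
  simp only [h]
  rw [dif_pos hex, dif_pos hex]

/-- parent -/
noncomputable def par (D : Dat n) (v : Fin n) : Fin n :=
  if D.pick v (D.idx v) = v then D.pick v (D.idx v - 1) else D.pick v (D.idx v)

/-- level of an edge -/
noncomputable def lev (D : Dat n) (v : Fin n) : ℕ :=
  if D.pick v (D.idx v) = v then D.idx v else 0

/-- priority of an edge -/
noncomputable def pri (D : Dat n) (v : Fin n) : ℕ := n * (n - D.lev v) + v

/-- edges between blocks -/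
noncomputable def R (D : Dat n) : Finset (Fin n) :=
  Finset.univ.filter fun v => D.pick v (D.idx v) = v ∧ 0 < D.idx v

lemma pri_inj (D : Dat n) : Function.Injective D.pri := by
  intro u v h
  unfold pri at h
  have := congrArg (· % n) h
  simp only [Nat.mul_add_mod, Nat.mod_eq_of_lt u.2, Nat.mod_eq_of_lt v.2] at this
  exact Fin.ext this

lemma lev_le (D : Dat n) (v : Fin n) : D.lev v ≤ D.idx v := by
  unfold lev; split <;> omega

lemma idx_lt_n (D : Dat n) (v : Fin n) : D.idx v < n := (D.idx_lt v).trans_le (D.length_le v)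

lemma pri_lt (D : Dat n) {u v : Fin n} (h : D.lev u < D.lev v) : D.pri v < D.pri u := by
  unfold pri
  have h1 := D.lev_le v
  have h2 := D.idx_lt_n v
  have h3 : (n - D.lev v) + 1 ≤ n - D.lev u := by omega
  have h4 := Nat.mul_le_mul_left n h3
  have := v.2
  rw [Nat.mul_add] at h4
  omega

lemma comp_par (D : Dat n) (v : Fin n) : D.comp (D.par v) = D.comp v := by
  unfold par
  have := D.idx_lt v
  split
  · exact (D.pick_spec v _ (by omega)).1
  · exact (D.pick_spec v _ (by omega)).1

lemma idx_par_le (D : Dat n) (v : Fin n) : D.idx (D.par v) ≤ D.idx v := by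
  unfold par
  have := D.idx_lt v
  split
  · rw [(D.pick_spec v _ (by omega)).2]; omega
  · rw [(D.pick_spec v _ (by omega)).2]

lemma conn (D : Dat n) (A : Finset (Fin n)) (c : Fin n) (m : ℕ)
    (h : ∀ x, D.comp x = D.comp c → D.lev x < m → dc D.par A x = 0) (i : ℕ) :
    ∀ u, D.comp u = D.comp c → D.idx u = i → i < m → (u ∈ A ↔ D.pick c 0 ∈ A) := by
  induction i with
  | zero =>
    intro u hu hi hm
    have hl := D.idx_lt u
    have e : D.pick u (D.idx u) = D.pick c 0 := by
      rw [hi]; exact D.pick_congr 0 (by rw [← hu]; omega) hu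
    by_cases ht : D.pick u (D.idx u) = u
    · rw [← e, ht]
    · have := h u hu (by unfold lev; rw [if_neg ht]; exact hm)
      rw [dc_eq_zero] at this
      unfold par at this
      rw [if_neg ht, e] at this
      exact this.symm
  | succ i ih =>
    intro u hu hi hm
    have hl := D.idx_lt u
    obtain ⟨s1, s2⟩ := D.pick_spec u (i + 1) (by omega)
    have hui : (u ∈ A ↔ D.pick u (i + 1) ∈ A) := by
      by_cases ht : D.pick u (D.idx u) = u
      · rw [← hi, ht]
      · have := h u hu (by unfold lev; rw [if_neg ht]; omega)
        rw [dc_eq_zero] at this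
        unfold par at this
        rw [if_neg ht, hi] at this
        exact this.symm
    rw [hui]
    set t := D.pick u (i + 1) with ht
    have htop : D.pick t (D.idx t) = t := by
      rw [s2, D.pick_congr (i + 1) (by omega) s1]
    have := h t (s1.trans hu) (by unfold lev; rw [if_pos htop]; omega)
    rw [dc_eq_zero] at this
    rw [← this]
    refine ih _ ?_ ?_ (by omega)
    · rw [comp_par, s1, hu]
    · unfold par
      rw [if_pos htop, (D.pick_spec t _ (by rw [s1, s2]; omega)).2]
      omega

/-- signed weights -/
noncomputable def wt (D : Dat n) (E : Finset (Fin n)) (v : Fin n) : ℝ :=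
  (if v ∈ E then -1 else 1) * 2 ^ D.pri v

lemma abs_wt (D : Dat n) (E : Finset (Fin n)) (v : Fin n) : |D.wt E v| = 2 ^ D.pri v := by
  unfold wt
  rw [abs_mul, abs_of_pos (show (0 : ℝ) < 2 ^ D.pri v by positivity)]
  split <;> simp

/-- test functional -/
noncomputable def phi (D : Dat n) : ((Fin n → ℝ) → ℚ) →ₗ[ℚ] ℚ :=
  ∑ E ∈ D.R.powerset, ((-1 : ℚ) ^ E.card) • LinearMap.proj (pt D.par (D.wt E))

lemma phi_apply (D : Dat n) (f : (Fin n → ℝ) → ℚ) :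
    D.phi f = ∑ E ∈ D.R.powerset, (-1 : ℚ) ^ E.card * f (pt D.par (D.wt E)) := by
  simp [phi]

lemma K_nocut (D : Dat n) (v u : Fin n) : dc D.par (D.K v) u = 0 := by
  rw [dc_eq_zero]; simp [K, comp_par]

lemma mem_cone_self (D : Dat n) (E : Finset (Fin n)) (hE : E ⊆ D.R) :
    pt D.par (D.wt E) ∈ D.cone ↔ E = ∅ := by
  constructor
  · intro h
    rw [Finset.eq_empty_iff_forall_notMem]
    intro v hv
    have hR := hE hv
    simp only [R, Finset.mem_filter, Finset.mem_univ, true_and] at hR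
    have hl := D.idx_lt v
    have h1 := (h v).2 (D.idx v) hR.2 hl
    rw [sum_pt, Finset.sum_eq_single v] at h1
    · have : dc D.par (D.T v (D.idx v)) v = 1 := by
        have hp : D.par v ∈ D.T v (D.idx v) := by
          simp only [T, Finset.mem_filter, Finset.mem_univ, true_and, comp_par]
          unfold par
          rw [if_pos hR.1, (D.pick_spec v _ (by omega)).2]
          omega
        have hn : v ∉ D.T v (D.idx v) := by simp [T]
        simp [dc, hp, hn]
      rw [this, wt, if_pos hv] at h1
      have : (0 : ℝ) < 2 ^ D.pri v := by positivity
      linarith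
    · intro u _ hne
      have : dc D.par (D.T v (D.idx v)) u = 0 := by
        rw [dc_eq_zero]
        simp only [T, Finset.mem_filter, Finset.mem_univ, true_and, comp_par]
        refine and_congr_right fun hu => ⟨fun hlt => ?_, fun hlt => (D.idx_par_le u).trans_lt hlt⟩
        by_contra hge
        have hlu := D.idx_lt u
        unfold par at hlt
        split at hlt
        · rename_i ht
          rw [(D.pick_spec u _ (by omega)).2] at hlt
          have : D.idx u = D.idx v := by omega
          apply hne
          rw [← ht, ← hR.1, this]
          exact D.pick_congr _ hl hu
        · rw [(D.pick_spec u _ (by omega)).2] at hlt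
          exact hge hlt
      rw [this, mul_zero]
    · simp
  · rintro rfl v
    refine ⟨?_, fun i h0 hi => ?_⟩
    · rw [sum_pt]; simp [K_nocut]
    · rw [sum_pt]
      refine Finset.sum_nonneg fun u _ => mul_nonneg (by simp [wt]) ?_
      unfold dc
      by_cases hu : u ∈ D.T v i
      · have : D.par u ∈ D.T v i := by
          simp only [T, Finset.mem_filter, Finset.mem_univ, true_and, comp_par] at hu ⊢
          exact ⟨hu.1, (D.idx_par_le u).trans_lt hu.2⟩
        simp [hu, this]
      · simp only [hu, if_false, sub_zero]
        split <;> norm_num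

lemma phi_self (D : Dat n) : D.phi (ind D.cone) = 1 := by
  rw [phi_apply, Finset.sum_eq_single ∅]
  · simp [ind, D.mem_cone_self ∅ (by simp)]
  · intro E hE hne
    have := (D.mem_cone_self E (Finset.mem_powerset.1 hE)).not.2 hne
    simp [ind, this]
  · simp

lemma phi_ne (D G : Dat n) (h : D.phi (ind G.cone) ≠ 0) :
    (∀ u, D.K u ⊆ G.K u) ∧
    ∀ v ∈ D.R, ∃ u i, 0 < i ∧ i < (G.comp u).length ∧ MaxCut D.par D.pri (G.T u i) v := by
  rw [phi_apply] at h
  constructor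
  · obtain ⟨E, -, hE⟩ := Finset.exists_ne_zero_of_sum_ne_zero h
    have hmem : pt D.par (D.wt E) ∈ G.cone := by
      by_contra hc
      simp [ind, hc] at hE
    intro u a ha
    have h0 := (sum_pt_eq_zero D.par D.pri D.pri_inj (D.wt E) (D.abs_wt E) (G.K u)).1 (hmem u).1
    simp only [K, Finset.mem_filter, Finset.mem_univ, true_and] at ha
    have c1 := D.conn (G.K u) u n (fun x _ _ => h0 x) _ a ha rfl (D.idx_lt_n a)
    have c2 := D.conn (G.K u) u n (fun x _ _ => h0 x) _ u rfl rfl (D.idx_lt_n u)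
    rw [c1, ← c2]
    simp [K]
  · intro v hv
    by_contra hc
    push Not at hc
    apply h
    rw [← Finset.insert_erase hv, Finset.sum_powerset_insert (Finset.notMem_erase _ _),
      ← Finset.sum_add_distrib]
    refine Finset.sum_eq_zero fun E hE => ?_
    have hvE : v ∉ E := fun h => Finset.notMem_erase v D.R (Finset.mem_powerset.1 hE h)
    have hiff : pt D.par (D.wt E) ∈ G.cone ↔ pt D.par (D.wt (insert v E)) ∈ G.cone := by
      refine forall_congr' fun u => and_congr ?_ ?_
      · rw [sum_pt_eq_zero D.par D.pri D.pri_inj _ (D.abs_wt _),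
          sum_pt_eq_zero D.par D.pri D.pri_inj _ (D.abs_wt _)]
      · refine forall_congr' fun i => forall_congr' fun h0 => forall_congr' fun hi => ?_
        by_cases hz : ∀ x, dc D.par (G.T u i) x = 0
        · rw [sum_pt, sum_pt]; simp [hz]
        · obtain ⟨x, hx⟩ := maxCut_exists D.par D.pri _ hz
          rw [sum_pt_nonneg D.par D.pri D.pri_inj _ (D.abs_wt _) _ x hx,
            sum_pt_nonneg D.par D.pri D.pri_inj _ (D.abs_wt _) _ x hx]
          have hne : x ≠ v := by rintro rfl; exact hc u i h0 hi hx
          simp [wt, hne]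
    rw [Finset.card_insert_of_notMem hvE, pow_succ]
    simp only [ind, hiff]
    ring

/-- number of walls containing an element -/
def co (D : Dat n) (u : Fin n) : ℕ := (D.comp u).length - 1 - D.idx u

/-- pointwise rank -/
noncomputable def key (D : Dat n) (u : Fin n) : ℕ := n * (D.K u).card + D.co u

lemma co_lt (D : Dat n) (u : Fin n) : D.co u < n := by
  have := D.length_le u
  have := D.idx_lt u
  unfold co; omega

lemma mem_K (D : Dat n) (u a : Fin n) : a ∈ D.K u ↔ D.comp a = D.comp u := by simp [K]

lemma K_congr (D : Dat n) {u v : Fin n} (h : D.comp u = D.comp v) : D.K u = D.K v := by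
  simp [K, h]

/-- the minimum of a component shared by two data sets has index zero in both -/
lemma common_min (D G : Dat n) (u : Fin n) (hK : D.K u = G.K u) :
    ∃ b, D.comp b = D.comp u ∧ G.comp b = G.comp u ∧ D.idx b = 0 ∧ G.idx b = 0 := by
  obtain ⟨b, b1, b2, b3⟩ := D.std u
  obtain ⟨c, c1, c2, c3⟩ := G.std u
  have hb : b ∈ D.K u := (D.mem_K u b).2 b1
  have hc : c ∈ G.K u := (G.mem_K u c).2 c1
  rw [hK, mem_K] at hb
  rw [← hK, mem_K] at hc
  have : b = c := le_antisymm (b3 c hc) (c3 b hb)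
  subst this
  exact ⟨b, b1, c1, b2, c2⟩

lemma step_lt (D G : Dat n) (h1 : ∀ u, D.K u ⊆ G.K u)
    (h2 : ∀ v ∈ D.R, ∃ u i, 0 < i ∧ i < (G.comp u).length ∧ MaxCut D.par D.pri (G.T u i) v)
    (u w : Fin n) (huw : D.comp w = D.comp u) (hi : D.idx w = D.idx u + 1)
    (hK : D.K u = G.K u) : G.idx u < G.idx w := by
  have hlw := D.idx_lt w
  set t := D.pick w (D.idx w) with ht
  obtain ⟨s1, s2⟩ := D.pick_spec w (D.idx w) hlw
  rw [← ht] at s1 s2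
  have htop : D.pick t (D.idx t) = t := by
    rw [s2, D.pick_congr _ hlw s1]
  have htR : t ∈ D.R := by
    simp only [R, Finset.mem_filter, Finset.mem_univ, true_and]
    exact ⟨htop, by omega⟩
  obtain ⟨z, j, hj0, hj, hcut, hmax⟩ := h2 t htR
  set A := G.T z j with hA
  have memA : ∀ a, a ∈ A ↔ G.comp a = G.comp z ∧ G.idx a < j := by
    intro a; simp [hA, T]
  have sub : ∀ a, D.comp a = D.comp u → G.comp a = G.comp u := by
    intro a ha
    exact (G.mem_K u a).1 (h1 u ((D.mem_K u a).2 ha))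
  have hzu : G.comp z = G.comp u := by
    have e1 := sub t (s1.trans huw)
    have e2 := sub (D.par t) ((D.comp_par t).trans (s1.trans huw))
    rw [Ne, dc_eq_zero] at hcut
    by_cases hm : t ∈ A
    · rw [← e1]; exact ((memA t).1 hm).1.symm
    · have : D.par t ∈ A := by tauto
      rw [← e2]; exact ((memA _).1 this).1.symm
  obtain ⟨b, b1, b2, b3, b4⟩ := D.common_min G u hK
  have hbA : b ∈ A := (memA b).2 ⟨b2.trans hzu.symm, by omega⟩
  have hlevt : D.lev t = D.idx w := by unfold lev; rw [if_pos htop, s2]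
  have hno : ∀ x, D.lev x < D.idx w → dc D.par A x = 0 := by
    intro x hx
    by_contra hne
    have := hmax x hne
    have := D.pri_lt (hlevt ▸ hx : D.lev x < D.lev t)
    omega
  have hin : ∀ a, D.comp a = D.comp u → D.idx a < D.idx w → a ∈ A := by
    intro a ha hia
    have c1 := D.conn A u (D.idx w) (fun x _ hx => hno x hx) _ a ha rfl hia
    have c2 := D.conn A u (D.idx w) (fun x _ hx => hno x hx) _ b b1 rfl (by omega)
    rw [c1, ← c2]; exact hbA
  have huA : u ∈ A := hin u rfl (by omega)
  have hpA : D.par t ∈ A := by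
    refine hin _ ((D.comp_par t).trans (s1.trans huw)) ?_
    unfold par
    rw [if_pos htop, (D.pick_spec t _ (by rw [s1, s2]; omega)).2]
    omega
  have htA : t ∉ A := by
    intro h
    exact hcut ((dc_eq_zero _ _ _).2 ⟨fun _ => h, fun _ => hpA⟩)
  have hwA : w ∉ A := by
    by_cases e : t = w
    · rw [← e]; exact htA
    · have := hno w (by unfold lev; rw [if_neg (ht ▸ e)]; omega)
      rw [dc_eq_zero] at this
      unfold par at this
      rw [if_neg (ht ▸ e), ← ht] at this
      rw [← this]; exact htA
  have hu' := (memA u).1 huA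
  by_contra hge
  exact hwA ((memA w).2 ⟨(sub w huw).trans hzu.symm, by omega⟩)

lemma co_le (D G : Dat n) (h1 : ∀ u, D.K u ⊆ G.K u)
    (h2 : ∀ v ∈ D.R, ∃ u i, 0 < i ∧ i < (G.comp u).length ∧ MaxCut D.par D.pri (G.T u i) v)
    (c : ℕ) : ∀ u, D.K u = G.K u → D.co u = c → c ≤ G.co u := by
  induction c with
  | zero => intro u _ _; exact Nat.zero_le _
  | succ c ih =>
    intro u hK hc
    have hl := D.idx_lt u
    unfold co at hc
    obtain ⟨w, w1, w2⟩ := D.ex u (D.idx u + 1) (by omega)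
    have hlt := step_lt D G h1 h2 u w w1 w2 hK
    have hwG : G.comp w = G.comp u := (G.mem_K u w).1 (h1 u ((D.mem_K u w).2 w1))
    have := ih w (by rw [D.K_congr w1, G.K_congr hwG, hK]) (by unfold co; rw [w1, w2]; omega)
    have hlw := G.idx_lt w
    unfold co at this ⊢
    rw [hwG] at this hlw
    omega

lemma key_le (D G : Dat n) (h : D.phi (ind G.cone) ≠ 0) (u : Fin n) :
    D.key u ≤ G.key u ∧ (D.key u = G.key u → D.K u = G.K u ∧ D.co u = G.co u) := by
  obtain ⟨h1, h2⟩ := phi_ne D G h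
  have hle := Finset.card_le_card (h1 u)
  have hco := D.co_lt u
  unfold key
  rcases hle.eq_or_lt with he | hlt
  · have hK := Finset.eq_of_subset_of_card_le (h1 u) he.ge
    have := co_le D G h1 h2 _ u hK rfl
    rw [he]
    exact ⟨by omega, fun h => ⟨hK, by omega⟩⟩
  · have := Nat.mul_le_mul_left n (Nat.succ_le_of_lt hlt)
    rw [Nat.mul_succ] at this
    exact ⟨by omega, fun h => by omega⟩

lemma eq_of_key {D G : Dat n} {F H : Finset (List (Finset (Fin n)))} (hD : D.For F) (hG : G.For H)
    (hF : IsStdCSP n F) (hH : IsStdCSP n H)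
    (h : ∀ u, D.K u = G.K u ∧ D.co u = G.co u) : F = H := by
  have hl : ∀ v, (D.comp v).length = (G.comp v).length := by
    intro v
    obtain ⟨b, b1, b2, b3, b4⟩ := D.common_min G v (h v).1
    have e := (h b).2
    unfold co at e
    rw [b1, b2, b3, b4] at e
    have := D.idx_lt v
    have := G.idx_lt v
    omega
  refine hD.eq hG hF hH (fun v => (h v).1) hl fun v => ?_
  have e := (h v).2
  unfold co at e
  have := D.idx_lt v
  have := G.idx_lt v
  have := hl v
  omega

end Dat

lemma linIndep (n : ℕ) : LinearIndependent ℚ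
      (fun F : {F : Finset (List (Finset (Fin n))) // IsStdCSP n F} =>
        ind (∑ M ∈ F.1, plate M)) := by
  choose D hD using fun F : {F : Finset (List (Finset (Fin n))) // IsStdCSP n F} =>
    Dat.exists_for F.1 F.2
  have hfun : (fun F : {F : Finset (List (Finset (Fin n))) // IsStdCSP n F} =>
        ind (∑ M ∈ F.1, plate M)) = fun F => ind (D F).cone := by
    funext F; rw [(hD F).cone_eq F.2]
  rw [hfun, linearIndependent_iff']
  intro s g hs
  by_contra hc
  push Not at hc
  obtain ⟨F0, hF0, hg0⟩ := hc
  obtain ⟨F, hF, hmax⟩ := Finset.exists_max_image (s.filter fun F => g F ≠ 0)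
    (fun F => ∑ u, (D F).key u) ⟨F0, by simp [hF0, hg0]⟩
  rw [Finset.mem_filter] at hF
  have h1 := congrArg (D F).phi hs
  rw [map_sum, map_zero, Finset.sum_eq_single F] at h1
  · rw [map_smul, Dat.phi_self] at h1
    exact hF.2 (by simpa using h1)
  · intro G hG hne
    rw [map_smul]
    by_cases hg : g G = 0
    · simp [hg]
    by_cases hphi : (D F).phi (ind (D G).cone) = 0
    · simp [hphi]
    exfalso
    have hle := hmax G (by simp [hG, hg])
    have hk := Dat.key_le (D F) (D G) hphi
    have heq : ∑ u, (D F).key u = ∑ u, (D G).key u :=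
      le_antisymm (Finset.sum_le_sum fun u _ => (hk u).1) hle
    rw [Finset.sum_eq_sum_iff_of_le fun u _ => (hk u).1] at heq
    apply hne
    apply Subtype.ext
    exact (Dat.eq_of_key (hD F) (hD G) F.2 G.2
      fun u => (hk u).2 (heq u (Finset.mem_univ u))).symm
  · intro h; exact absurd hF.1 h

lemma finite_osp (n : ℕ) : Finite {L : List (Finset (Fin n)) // IsOSP Finset.univ L} := by
  have : Function.Injective (fun L : {L : List (Finset (Fin n)) // IsOSP Finset.univ L} =>
      (⟨L.1, (L.2.2.1.imp_of_mem (fun {a b} ha _ hab e => by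
        subst e
        exact (L.2.1 a ha).ne_empty (by simpa using hab)))⟩ :
        {L : List (Finset (Fin n)) // L.Nodup})) := by
    intro L L' h
    simpa [Subtype.ext_iff] using h
  exact Finite.of_injective _ this

/-- The functions `[[S₁]] • ⋯ • [[S_l]]` (indicators of the Minkowski
sums of the plates of the members of a standard composite set partition), indexed by the
standard composite set partitions of `{1,…,n}`, form a basis of the `ℚ`-vector space
spanned by the indicator functions of the plates of all ordered set partitions of
`{1,…,n}`: they are linearly independent and have the same span. -/
theorem statement_9 (n : ℕ) :
    LinearIndependent ℚ
      (fun F : {F : Finset (List (Finset (Fin n))) // IsStdCSP n F} =>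
        ind (∑ M ∈ F.1, plate M)) ∧
    Submodule.span ℚ (Set.range
      (fun F : {F : Finset (List (Finset (Fin n))) // IsStdCSP n F} =>
        ind (∑ M ∈ F.1, plate M))) =
    Submodule.span ℚ (Set.range
      (fun L : {L : List (Finset (Fin n)) // IsOSP Finset.univ L} =>
        ind (plate L.1))) := by
  have hli := linIndep n
  refine ⟨hli, ?_⟩
  have hfin := finite_osp n
  have hfd : FiniteDimensional ℚ (Submodule.span ℚ (Set.range
      (fun L : {L : List (Finset (Fin n)) // IsOSP Finset.univ L} => ind (plate L.1)))) :=
    FiniteDimensional.span_of_finite ℚ (Set.finite_range _)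
  have hle : Submodule.span ℚ (Set.range
      (fun F : {F : Finset (List (Finset (Fin n))) // IsStdCSP n F} =>
        ind (∑ M ∈ F.1, plate M))) ≤
    Submodule.span ℚ (Set.range
      (fun L : {L : List (Finset (Fin n)) // IsOSP Finset.univ L} =>
        ind (plate L.1))) := by
    rw [Submodule.span_le]
    rintro _ ⟨F, rfl⟩
    exact ind_sum_mem F.1 F.2
  have hfd' := Submodule.finiteDimensional_of_le hle
  have hspanli := linearIndependent_span hli
  have hfinF : Finite {F : Finset (List (Finset (Fin n))) // IsStdCSP n F} := hspanli.finite
  have := Fintype.ofFinite {F : Finset (List (Finset (Fin n))) // IsStdCSP n F}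
  have := Fintype.ofFinite {L : List (Finset (Fin n)) // IsOSP Finset.univ L}
  obtain ⟨f, hf⟩ := exists_inj n
  refine Submodule.eq_of_le_of_finrank_le hle ?_
  rw [finrank_span_eq_card hli]
  exact (finrank_range_le_card _).trans (Fintype.card_le_of_injective f hf)

end PlatesPaper
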